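/- arXiv:math/0506516 — 2 statements merged into one kernel-verified Lean document; each statement's English description precedes it below -/
import Mathlib

section
/- Let X be a closed subset of ℝ^N (with the Euclidean metric), T : X → X a Borel measurable map, and μ a T-invariant finite Borel measure on X. Then for μ-almost every x ∈ X the quantitative recurrence indicators are bounded above by the local dimensions: R̄(x,x) ≤ d̄_μ(x) and R_(x,x) ≤ d_μ(x). -/
open Filter MeasureTheory Metric Set

/-- Hitting time of the ball `B(y,r)` by the orbit of `x` under `T`
    (`⊤` if the forward orbit never enters the ball). -/
noncomputable def hitTime {X : Type*} [MetricSpace X] (T : X → X) (x y : X) (r : ℝ) : ℕ∞ :=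
  sInf {n : ℕ∞ | ∃ k : ℕ, n = k ∧ 0 < k ∧ T^[k] x ∈ Metric.ball y r}

/-- The quantity `log τ_r(x,y) / (- log r)`, set to `⊤` when the hitting time is infinite. -/
noncomputable def hitQuot {X : Type*} [MetricSpace X] (T : X → X) (x y : X) (r : ℝ) : EReal :=
  if hitTime T x y r = ⊤ then (⊤ : EReal)
  else ((Real.log ((hitTime T x y r).toNat) / (-Real.log r) : ℝ) : EReal)

/-- Upper hitting-time indicator `R̄(x,y)`. -/
noncomputable def Rbar {X : Type*} [MetricSpace X] (T : X → X) (x y : X) : EReal :=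
  Filter.limsup (hitQuot T x y) (nhdsWithin 0 (Set.Ioi 0))

/-- Lower hitting-time indicator `R_(x,y)`. -/
noncomputable def Rlow {X : Type*} [MetricSpace X] (T : X → X) (x y : X) : EReal :=
  Filter.liminf (hitQuot T x y) (nhdsWithin 0 (Set.Ioi 0))

/-- Upper local dimension of `μ` at `x`. -/
noncomputable def upperLocalDim {X : Type*} [MetricSpace X] [MeasurableSpace X]
    (μ : MeasureTheory.Measure X) (x : X) : EReal :=
  Filter.limsup
    (fun r : ℝ => ((Real.log (μ (Metric.ball x r)).toReal / Real.log r : ℝ) : EReal))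
    (nhdsWithin 0 (Set.Ioi 0))

/-- Lower local dimension of `μ` at `x`. -/
noncomputable def lowerLocalDim {X : Type*} [MetricSpace X] [MeasurableSpace X]
    (μ : MeasureTheory.Measure X) (x : X) : EReal :=
  Filter.liminf
    (fun r : ℝ => ((Real.log (μ (Metric.ball x r)).toReal / Real.log r : ℝ) : EReal))
    (nhdsWithin 0 (Set.Ioi 0))

open scoped ENNReal Topology

/-- If `D` never returns to itself within the first `m` iterates, then its first `m + 1` preimages
are disjoint, so that `(m + 1) μ(D) ≤ μ(α)`. -/
theorem succ_mul_measure_le_of_no_return {α : Type*} [MeasurableSpace α] {μ : Measure α}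
    {T : α → α} (hT : MeasurePreserving T μ μ) {D : Set α} (hD : MeasurableSet D) {m : ℕ}
    (h : ∀ x ∈ D, ∀ j, 0 < j → j ≤ m → T^[j] x ∉ D) :
    ((m + 1 : ℕ) : ℝ≥0∞) * μ D ≤ μ univ := by
  have hmono : ∀ i j, i < j → j ≤ m → Disjoint (T^[i] ⁻¹' D) (T^[j] ⁻¹' D) := by
    intro i j hij hj
    rw [Set.disjoint_left]
    intro x hi hx
    refine h _ hi (j - i) (by omega) (by omega) ?_
    rw [← Function.iterate_add_apply, Nat.sub_add_cancel hij.le]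
    exact hx
  have hdisj : Set.PairwiseDisjoint (↑(Finset.range (m + 1))) fun j => T^[j] ⁻¹' D := by
    intro i hi j hj hij
    simp only [Finset.coe_range, Set.mem_Iio] at hi hj
    rcases lt_or_gt_of_ne hij with h' | h'
    · exact hmono i j h' (by omega)
    · exact (hmono j i h' (by omega)).symm
  calc ((m + 1 : ℕ) : ℝ≥0∞) * μ D
      = ∑ j ∈ Finset.range (m + 1), μ (T^[j] ⁻¹' D) := by
        simp [(hT.iterate _).measure_preimage hD.nullMeasurableSet]
    _ = μ (⋃ j ∈ Finset.range (m + 1), T^[j] ⁻¹' D) :=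
        (measure_biUnion_finset hdisj fun j _ => (hT.iterate j).measurable hD).symm
    _ ≤ μ univ := measure_mono (subset_univ _)

/-- Summing a bound over the fibres of a countably valued map. -/
theorem measure_le_tsum_fiber {α ι : Type*} [MeasurableSpace α] (μ : Measure α) [Countable ι]
    (f : α → ι) (s : Set α) : μ s ≤ ∑' k, μ (s ∩ f ⁻¹' {k}) := by
  refine (measure_mono ?_).trans (measure_iUnion_le _)
  intro x hx
  simp [hx]

theorem tsum_measure_fiber {α ι : Type*} [MeasurableSpace α] (μ : Measure α) [Countable ι]
    [MeasurableSpace ι] [MeasurableSingletonClass ι] {f : α → ι} (hf : Measurable f) :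
    ∑' k, μ (f ⁻¹' {k}) = μ univ := by
  have h := tsum_measure_preimage_singleton (μ := μ) (f := f) (to_countable (univ : Set ι))
    (fun y _ => hf (measurableSet_singleton y))
  rw [tsum_univ (fun k => μ (f ⁻¹' {k}))] at h
  simpa using h

/-- The points that do not return to their own cell `Q` within time `M / μ(Q)` have measure at most
`μ(α)² / M`. -/
theorem mul_measure_no_fast_return_le {α ι : Type*} [MeasurableSpace α] {μ : Measure α}
    [IsFiniteMeasure μ] [Countable ι] [MeasurableSpace ι] [MeasurableSingletonClass ι]
    {T : α → α} (hT : MeasurePreserving T μ μ) {f : α → ι} (hf : Measurable f) (M : ℝ) :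
    ENNReal.ofReal M *
      μ {x | ∀ j : ℕ, 0 < j → f (T^[j] x) = f x → M < j * μ.real (f ⁻¹' {f x})}
      ≤ μ univ * μ univ := by
  set s := {x | ∀ j : ℕ, 0 < j → f (T^[j] x) = f x → M < j * μ.real (f ⁻¹' {f x})} with hs
  have key : ∀ k, ENNReal.ofReal M * μ (s ∩ f ⁻¹' {k}) ≤ μ (f ⁻¹' {k}) * μ univ := by
    intro k
    rcases eq_or_ne (μ (f ⁻¹' {k})) 0 with h0 | h0
    · simp [measure_mono_null inter_subset_right h0]
    have hpos : 0 < μ.real (f ⁻¹' {k}) := ENNReal.toReal_pos h0 (measure_ne_top _ _)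
    set m := ⌊M / μ.real (f ⁻¹' {k})⌋₊ with hm
    rcases le_or_gt M 0 with hM | hM
    · simp [ENNReal.ofReal_eq_zero.2 hM]
    set D := f ⁻¹' {k} ∩ ⋂ j ∈ Finset.Icc 1 m, (T^[j] ⁻¹' (f ⁻¹' {k}))ᶜ with hD
    have hQ : MeasurableSet (f ⁻¹' {k}) := hf (measurableSet_singleton k)
    have hDm : MeasurableSet D :=
      hQ.inter (Finset.measurableSet_biInter _ fun j _ => ((hT.iterate j).measurable hQ).compl)
    have hret := succ_mul_measure_le_of_no_return hT hDm (m := m) (by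
      intro x hx j hj hjm hxD
      have := Set.mem_iInter₂.1 hx.2 j (Finset.mem_Icc.2 ⟨hj, hjm⟩)
      exact this hxD.1)
    have hsub : s ∩ f ⁻¹' {k} ⊆ D := by
      rintro x ⟨hx, hxk⟩
      refine ⟨hxk, Set.mem_iInter₂.2 fun j hj hjk => ?_⟩
      rw [Finset.mem_Icc] at hj
      simp only [mem_preimage, mem_singleton_iff] at hxk hjk
      have h1 := hx j (by omega) (by rw [hjk, hxk])
      rw [hxk] at h1
      have h2 : (j : ℝ) ≤ M / μ.real (f ⁻¹' {k}) :=
        (Nat.cast_le.2 hj.2).trans (Nat.floor_le (by positivity))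
      rw [le_div_iff₀ hpos] at h2
      linarith
    have hMle : ENNReal.ofReal M ≤ ((m + 1 : ℕ) : ℝ≥0∞) * μ (f ⁻¹' {k}) := by
      have h1 : M ≤ ((m + 1 : ℕ) : ℝ) * μ.real (f ⁻¹' {k}) := by
        rw [← div_le_iff₀ hpos]
        push_cast
        exact (Nat.lt_floor_add_one _).le
      refine (ENNReal.ofReal_le_ofReal h1).trans_eq ?_
      rw [ENNReal.ofReal_mul (by positivity), ENNReal.ofReal_natCast, ofReal_measureReal]
    calc ENNReal.ofReal M * μ (s ∩ f ⁻¹' {k})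
        ≤ (((m + 1 : ℕ) : ℝ≥0∞) * μ (f ⁻¹' {k})) * μ D := by gcongr
      _ = μ (f ⁻¹' {k}) * (((m + 1 : ℕ) : ℝ≥0∞) * μ D) := by ring
      _ ≤ μ (f ⁻¹' {k}) * μ univ := by gcongr
  calc ENNReal.ofReal M * μ s ≤ ENNReal.ofReal M * ∑' k, μ (s ∩ f ⁻¹' {k}) := by
        gcongr; exact measure_le_tsum_fiber μ f s
    _ = ∑' k, ENNReal.ofReal M * μ (s ∩ f ⁻¹' {k}) := ENNReal.tsum_mul_left.symm
    _ ≤ ∑' k, μ (f ⁻¹' {k}) * μ univ := ENNReal.tsum_le_tsum key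
    _ = μ univ * μ univ := by rw [ENNReal.tsum_mul_right, tsum_measure_fiber μ hf]

/-- The points whose cell carries less than the fraction `1 / M` of the mass of the union of the
neighbouring cells (those differing by an element of `E`) have measure at most
`|E| μ(α) / M`. -/
theorem mul_measure_light_cell_le {α G : Type*} [MeasurableSpace α] {μ : Measure α}
    [AddCommGroup G] [Countable G] [MeasurableSpace G] [MeasurableSingletonClass G]
    {f : α → G} (hf : Measurable f) (E : Finset G) (M : ℝ≥0∞) :
    M * μ {x | M * μ (f ⁻¹' {f x}) < μ {y | f y - f x ∈ E}} ≤ E.card * μ univ := by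
  set s := {x | M * μ (f ⁻¹' {f x}) < μ {y | f y - f x ∈ E}} with hs
  have key : ∀ k, M * μ (s ∩ f ⁻¹' {k}) ≤ ∑ e ∈ E, μ (f ⁻¹' {k + e}) := by
    intro k
    rcases (s ∩ f ⁻¹' {k}).eq_empty_or_nonempty with h0 | ⟨x, hx, hxk⟩
    · simp [h0]
    simp only [mem_preimage, mem_singleton_iff] at hxk
    simp only [hs, mem_ofPred_eq, hxk] at hx
    calc M * μ (s ∩ f ⁻¹' {k}) ≤ M * μ (f ⁻¹' {k}) := by gcongr; exact inter_subset_right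
      _ ≤ μ {y | f y - k ∈ E} := hx.le
      _ ≤ μ (⋃ e ∈ E, f ⁻¹' {k + e}) := by
          refine measure_mono fun y hy => Set.mem_iUnion₂.2 ⟨_, hy, ?_⟩
          simp
      _ ≤ ∑ e ∈ E, μ (f ⁻¹' {k + e}) := measure_biUnion_finset_le _ _
  calc M * μ s ≤ M * ∑' k, μ (s ∩ f ⁻¹' {k}) := by
        gcongr; exact measure_le_tsum_fiber μ f s
    _ = ∑' k, M * μ (s ∩ f ⁻¹' {k}) := ENNReal.tsum_mul_left.symm
    _ ≤ ∑' k, ∑ e ∈ E, μ (f ⁻¹' {k + e}) := ENNReal.tsum_le_tsum key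
    _ = ∑ e ∈ E, ∑' k, μ (f ⁻¹' {k + e}) := Summable.tsum_finsetSum fun _ _ => ENNReal.summable
    _ = ∑ e ∈ E, μ univ := by
        refine Finset.sum_congr rfl fun e _ => ?_
        rw [← tsum_measure_fiber μ hf]
        exact (Equiv.addRight e).tsum_eq fun k => μ (f ⁻¹' {k})
    _ = E.card * μ univ := by simp

/-- Index of the dyadic cube of side `2⁻ⁿ` containing a point. -/
noncomputable def dyadicIndex {N : ℕ} (n : ℕ) (x : EuclideanSpace ℝ (Fin N)) : Fin N → ℤ :=
  fun i => ⌊x i * 2 ^ n⌋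

theorem measurable_dyadicIndex {N : ℕ} (n : ℕ) : Measurable (dyadicIndex (N := N) n) := by
  unfold dyadicIndex
  refine measurable_pi_lambda _ fun i => Int.measurable_floor.comp ?_
  fun_prop

theorem dist_lt_of_dyadicIndex_eq {N n : ℕ} {x y : EuclideanSpace ℝ (Fin N)}
    (h : dyadicIndex n x = dyadicIndex n y) : dist x y < (N + 1) * (1 / 2) ^ n := by
  have hc : ∀ i, (x i - y i) ^ 2 ≤ ((1 / 2 : ℝ) ^ n) ^ 2 := by
    intro i
    have h1 := Int.abs_sub_lt_one_of_floor_eq_floor (congrFun h i)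
    rw [← sub_mul, abs_mul, abs_of_pos (by positivity : (0 : ℝ) < 2 ^ n)] at h1
    rw [← sq_abs]
    refine pow_le_pow_left₀ (abs_nonneg _) ?_ 2
    rw [one_div, inv_pow, ← one_div, le_div_iff₀ (by positivity)]
    exact h1.le
  rw [EuclideanSpace.dist_eq]
  have hs : ∑ i, dist (x i) (y i) ^ 2 ≤ (N : ℝ) * ((1 / 2 : ℝ) ^ n) ^ 2 := by
    have := Finset.sum_le_card_nsmul Finset.univ (fun i => dist (x i) (y i) ^ 2) _
      fun i _ => by rw [Real.dist_eq, sq_abs]; exact hc i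
    simpa using this
  have hp : (0 : ℝ) < (1 / 2) ^ n := by positivity
  rw [Real.sqrt_lt' (by positivity)]
  have hN : (0 : ℝ) ≤ N := N.cast_nonneg
  refine hs.trans_lt ?_
  rw [mul_pow]
  gcongr
  nlinarith

theorem dyadicIndex_sub_mem {N n : ℕ} {x y : EuclideanSpace ℝ (Fin N)}
    (h : dist y x < (1 / 2) ^ n) :
    dyadicIndex n y - dyadicIndex n x ∈ Finset.Icc (-1 : Fin N → ℤ) 1 := by
  have hc : ∀ i, |y i * 2 ^ n - x i * 2 ^ n| < 1 := by
    intro i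
    have h1 : |y i - x i| ≤ dist y x := by
      rw [dist_eq_norm]
      simpa using PiLp.norm_apply_le (y - x) i
    rw [← sub_mul, abs_mul, abs_of_pos (by positivity : (0 : ℝ) < 2 ^ n),
      ← lt_div_iff₀ (by positivity)]
    simpa using h1.trans_lt h
  rw [Finset.mem_Icc]
  constructor <;> intro i <;>
    simp only [Pi.sub_apply, Pi.neg_apply, Pi.one_apply, dyadicIndex] <;>
    have h1 := abs_lt.1 (hc i) <;>
    have hy := Int.floor_le (y i * 2 ^ n) <;>
    have hy' := Int.lt_floor_add_one (y i * 2 ^ n) <;>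
    have hx := Int.floor_le (x i * 2 ^ n) <;>
    have hx' := Int.lt_floor_add_one (x i * 2 ^ n)
  · have : (-2 : ℝ) < ((⌊y i * 2 ^ n⌋ - ⌊x i * 2 ^ n⌋ : ℤ) : ℝ) := by push_cast; linarith [h1.1]
    have : -2 < ⌊y i * 2 ^ n⌋ - ⌊x i * 2 ^ n⌋ := by exact_mod_cast this
    omega
  · have : ((⌊y i * 2 ^ n⌋ - ⌊x i * 2 ^ n⌋ : ℤ) : ℝ) < (2 : ℤ) := by
      push_cast; linarith [h1.2]
    have := Int.cast_lt.1 this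
    omega

/-- If `c > 1` then almost every point returns to the ball of radius `(N + 1) 2⁻ⁿ` around itself
within time `c²ⁿ / μ(B(x, 2⁻ⁿ))`, for all large `n`. -/
theorem ae_eventually_dyadic_return {N : ℕ} {X : Set (EuclideanSpace ℝ (Fin N))} {T : X → X}
    {μ : Measure X} [IsFiniteMeasure μ] (hT : MeasurePreserving T μ μ) {c : ℝ} (hc : 1 < c) :
    ∀ᵐ x ∂μ, ∀ᶠ n : ℕ in atTop, ∃ j : ℕ, 0 < j ∧ dist (T^[j] x) x < (N + 1) * (1 / 2) ^ n ∧
      j * μ.real (ball x ((1 / 2) ^ n)) ≤ c ^ n * c ^ n := by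
  have hc0 : 0 < c := by linarith
  let f : ℕ → X → (Fin N → ℤ) := fun n x => dyadicIndex n (x : EuclideanSpace ℝ (Fin N))
  have hf : ∀ n, Measurable (f n) := fun n => (measurable_dyadicIndex n).comp measurable_subtype_coe
  let E : Finset (Fin N → ℤ) := Finset.Icc (-1) 1
  have hsum : ∀ (s : ℕ → Set X) (K : ℝ≥0∞), K ≠ ∞ →
      (∀ n, ENNReal.ofReal (c ^ n) * μ (s n) ≤ K) → ∀ᵐ x ∂μ, ∀ᶠ n in atTop, x ∉ s n := by
    intro s K hK h
    refine ae_eventually_notMem (ne_top_of_le_ne_top ?_ (ENNReal.tsum_le_tsum fun n => ?_)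
      (b := ∑' n, K * ENNReal.ofReal c⁻¹ ^ n))
    · rw [ENNReal.tsum_mul_left]
      refine ENNReal.mul_ne_top hK ?_
      rw [ENNReal.tsum_geometric]
      refine ENNReal.inv_ne_top.2 (tsub_pos_of_lt ?_).ne'
      rw [ENNReal.ofReal_lt_one]
      exact inv_lt_one_of_one_lt₀ hc
    · calc μ (s n) = ENNReal.ofReal c⁻¹ ^ n * (ENNReal.ofReal (c ^ n) * μ (s n)) := by
            rw [← mul_assoc, ← ENNReal.ofReal_pow (by positivity),
              ← ENNReal.ofReal_mul (by positivity), ← mul_pow, inv_mul_cancel₀ hc0.ne']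
            simp
        _ ≤ ENNReal.ofReal c⁻¹ ^ n * K := by gcongr; exact h n
        _ = K * ENNReal.ofReal c⁻¹ ^ n := mul_comm _ _
  have h1 := hsum _ (μ univ * μ univ) (by finiteness)
    fun n => mul_measure_no_fast_return_le hT (hf n) (c ^ n)
  have h2 := hsum _ (E.card * μ univ) (by finiteness)
    fun n => mul_measure_light_cell_le (μ := μ) (hf n) E (ENNReal.ofReal (c ^ n))
  filter_upwards [h1, h2] with x hx1 hx2
  filter_upwards [hx1, hx2] with n hn1 hn2
  simp only [not_forall, not_lt] at hn1 hn2
  obtain ⟨j, hj, hfj, hjM⟩ := hn1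
  refine ⟨j, hj, dist_lt_of_dyadicIndex_eq hfj, ?_⟩
  have hball : μ.real (ball x ((1 / 2) ^ n)) ≤ c ^ n * μ.real (f n ⁻¹' {f n x}) := by
    have h3 : μ (ball x ((1 / 2) ^ n)) ≤ ENNReal.ofReal (c ^ n) * μ (f n ⁻¹' {f n x}) :=
      (measure_mono fun y hy => dyadicIndex_sub_mem hy).trans hn2
    have h4 := ENNReal.toReal_mono (by finiteness) h3
    rwa [ENNReal.toReal_mul, ENNReal.toReal_ofReal (by positivity)] at h4
  calc j * μ.real (ball x ((1 / 2) ^ n)) ≤ j * (c ^ n * μ.real (f n ⁻¹' {f n x})) := by gcongr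
    _ = c ^ n * (j * μ.real (f n ⁻¹' {f n x})) := by ring
    _ ≤ c ^ n * c ^ n := by gcongr

/-- For almost every `x` and small `r`, the point `x` returns to `B(x, 2(N+1)r)` within time
`r^{-ε} / μ(B(x, r))`. -/
theorem ae_eventually_return {N : ℕ} {X : Set (EuclideanSpace ℝ (Fin N))} {T : X → X}
    {μ : Measure X} [IsFiniteMeasure μ] (hT : MeasurePreserving T μ μ) {ε : ℝ} (hε : 0 < ε) :
    ∀ᵐ x ∂μ, ∀ᶠ r : ℝ in 𝓝[>] 0, ∃ j : ℕ, 0 < j ∧ T^[j] x ∈ ball x (2 * (N + 1) * r) ∧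
      j * μ.real (ball x r) ≤ r ^ (-ε) := by
  have hc : (1 : ℝ) < 2 ^ (ε / 2) := Real.one_lt_rpow (by norm_num) (by positivity)
  filter_upwards [ae_eventually_dyadic_return hT hc] with x hx
  obtain ⟨n₀, hn₀⟩ := eventually_atTop.1 hx
  have hr : ∀ᶠ r : ℝ in 𝓝[>] 0, r < (1 / 2) ^ n₀ :=
    nhdsWithin_le_nhds (eventually_lt_nhds (by positivity))
  filter_upwards [hr, self_mem_nhdsWithin] with r hr hr0
  rw [Set.mem_Ioi] at hr0
  have hr1 : r ≤ 1 := hr.le.trans (pow_le_one₀ (by norm_num) (by norm_num))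
  obtain ⟨n, hn, hn'⟩ := exists_nat_pow_near_of_lt_one hr0 hr1
    (by norm_num : (0 : ℝ) < 1 / 2) (by norm_num)
  have hnn : n₀ ≤ n := by
    have := (pow_lt_pow_iff_right_of_lt_one₀ (by norm_num) (by norm_num)).1 (hn.trans hr)
    omega
  obtain ⟨j, hj, hd, hm⟩ := hn₀ n hnn
  refine ⟨j, hj, ?_, ?_⟩
  · rw [mem_ball]
    refine hd.trans_le ?_
    rw [pow_succ] at hn
    have : (1 / 2 : ℝ) ^ n ≤ 2 * r := by linarith
    calc ((N : ℝ) + 1) * (1 / 2) ^ n ≤ (N + 1) * (2 * r) := by gcongr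
      _ = 2 * (N + 1) * r := by ring
  · calc j * μ.real (ball x r) ≤ j * μ.real (ball x ((1 / 2) ^ n)) := by
          refine mul_le_mul_of_nonneg_left ?_ j.cast_nonneg
          exact measureReal_mono (ball_subset_ball hn') (measure_ne_top _ _)
      _ ≤ (2 ^ (ε / 2)) ^ n * (2 ^ (ε / 2)) ^ n := hm
      _ = ((1 / 2 : ℝ) ^ n) ^ (-ε) := by
          rw [← mul_pow, ← Real.rpow_add (by norm_num), add_halves, one_div, inv_pow,
            Real.inv_rpow (by positivity), Real.rpow_neg (by positivity), inv_inv,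
            Real.rpow_pow_comm (by norm_num)]
      _ ≤ r ^ (-ε) := Real.rpow_le_rpow_of_nonpos hr0 hn' (by linarith)

theorem hitQuot_le_of_mem_ball {X : Type*} [MetricSpace X] {T : X → X} {x y : X} {r : ℝ} {j : ℕ}
    (hj : 0 < j) (h : T^[j] x ∈ ball y r) (hr0 : 0 < r) (hr1 : r < 1) :
    hitQuot T x y r ≤ ((Real.log j / -Real.log r : ℝ) : EReal) := by
  have hle : hitTime T x y r ≤ j := sInf_le ⟨j, rfl, hj, h⟩
  have hne : hitTime T x y r ≠ ⊤ := ne_top_of_le_ne_top (ENat.natCast_ne_top j) hle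
  rw [hitQuot, if_neg hne, EReal.coe_le_coe_iff]
  have hlog : 0 < -Real.log r := neg_pos.2 (Real.log_neg hr0 hr1)
  have hle' : (hitTime T x y r).toNat ≤ j := ENat.toNat_le_of_le_natCast hle
  have : Real.log (hitTime T x y r).toNat ≤ Real.log j := by
    rcases Nat.eq_zero_or_pos (hitTime T x y r).toNat with h0 | h0
    · rw [h0, Nat.cast_zero, Real.log_zero]
      exact Real.log_natCast_nonneg j
    · exact Real.log_le_log (by exact_mod_cast h0) (by exact_mod_cast hle')
  gcongr

/-- Quick returns to small balls bound the recurrence quotient at scale `C r` by the dimension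
quotient at scale `r`, up to an arbitrarily small error. -/
theorem eventually_hitQuot_le {X : Type*} [MetricSpace X] [MeasurableSpace X] {T : X → X}
    {μ : Measure X} {x : X} {C : ℝ} (hC : 0 < C)
    (hpos : ∀ r > 0, 0 < μ.real (ball x r))
    (hret : ∀ ε : ℝ, 0 < ε → ∀ᶠ r : ℝ in 𝓝[>] 0, ∃ j : ℕ, 0 < j ∧ T^[j] x ∈ ball x (C * r) ∧
      j * μ.real (ball x r) ≤ r ^ (-ε)) {a b : ℝ} (hab : a < b) :
    ∀ᶠ r : ℝ in 𝓝[>] 0, Real.log (μ (ball x r)).toReal / Real.log r < a →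
      hitQuot T x x (C * r) ≤ (b : EReal) := by
  have hε : 0 < (b - a) / 2 := by linarith
  have hC1 : ∀ᶠ r : ℝ in 𝓝[>] 0, r < C⁻¹ :=
    nhdsWithin_le_nhds (eventually_lt_nhds (by positivity))
  have hr1 : ∀ᶠ r : ℝ in 𝓝[>] 0, r < 1 :=
    nhdsWithin_le_nhds (eventually_lt_nhds (by positivity))
  have hL := Real.tendsto_log_nhdsGT_zero.eventually_le_atBot (-(b * Real.log C / ((b - a) / 2)))
  filter_upwards [hret _ hε, hC1, hr1, hL, self_mem_nhdsWithin] with r ⟨j, hj, hjr, hjm⟩ hrC hr1 hL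
    hr0 ha
  rw [Set.mem_Ioi] at hr0
  have hCr : C * r < 1 := by
    calc C * r < C * C⁻¹ := by gcongr
      _ = 1 := mul_inv_cancel₀ hC.ne'
  refine (hitQuot_le_of_mem_ball hj hjr (by positivity) hCr).trans (EReal.coe_le_coe_iff.2 ?_)
  have hj' : (0 : ℝ) < j := by exact_mod_cast hj
  have h1 := Real.log_le_log (mul_pos hj' (hpos r hr0)) hjm
  rw [Real.log_mul hj'.ne' (hpos r hr0).ne', Real.log_rpow hr0] at h1
  rw [div_lt_iff_of_neg (Real.log_neg hr0 hr1)] at ha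
  rw [div_le_iff₀ (neg_pos.2 (Real.log_neg (by positivity) hCr)), Real.log_mul hC.ne' hr0.ne']
  have h2 : b * Real.log C ≤ -Real.log r * ((b - a) / 2) := by
    rw [← div_le_iff₀ hε]
    linarith
  change a * Real.log r < Real.log (μ.real (ball x r)) at ha
  linarith

/-- for a closed subset of `ℝ^N` with an invariant finite Borel measure,
    the recurrence indicators are a.e. bounded above by the local dimensions. -/
theorem recurrence_le_dim {N : ℕ} (X : Set (EuclideanSpace ℝ (Fin N))) (hX : IsClosed X)
    (T : X → X) (hT : Measurable T) (μ : MeasureTheory.Measure X) [IsFiniteMeasure μ]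
    (hinv : MeasureTheory.MeasurePreserving T μ μ) :
    ∀ᵐ x ∂μ, Rbar T x x ≤ upperLocalDim μ x ∧ Rlow T x x ≤ lowerLocalDim μ x := by
  have hret : ∀ᵐ x ∂μ, ∀ m : ℕ, ∀ᶠ r : ℝ in 𝓝[>] 0, ∃ j : ℕ, 0 < j ∧
      T^[j] x ∈ ball x (2 * (N + 1) * r) ∧ j * μ.real (ball x r) ≤ r ^ (-(1 / ((m : ℝ) + 1))) :=
    ae_all_iff.2 fun m => ae_eventually_return hinv (by positivity)
  filter_upwards [hret, Measure.support_mem_ae (μ := μ)] with x hx hsupp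
  have hC : (0 : ℝ) < 2 * (N + 1) := by positivity
  set C : ℝ := 2 * (N + 1)
  have hpos : ∀ r > 0, 0 < μ.real (ball x r) := fun r hr =>
    ENNReal.toReal_pos ((Measure.mem_support_iff_forall x).1 hsupp _ (ball_mem_nhds x hr)).ne'
      (measure_ne_top _ _)
  have hret : ∀ ε : ℝ, 0 < ε → ∀ᶠ r : ℝ in 𝓝[>] 0, ∃ j : ℕ, 0 < j ∧ T^[j] x ∈ ball x (C * r) ∧
      j * μ.real (ball x r) ≤ r ^ (-ε) := by
    intro ε hε
    obtain ⟨m, hm⟩ := exists_nat_one_div_lt hε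
    have hr1 : ∀ᶠ r : ℝ in 𝓝[>] 0, r < 1 :=
      nhdsWithin_le_nhds (eventually_lt_nhds (by positivity))
    filter_upwards [hx m, hr1, self_mem_nhdsWithin] with r ⟨j, hj, hjr, hjm⟩ hr1 hr0
    exact ⟨j, hj, hjr, hjm.trans
      (Real.rpow_le_rpow_of_exponent_ge hr0 hr1.le (by linarith))⟩
  have hmul : ∀ c : ℝ, 0 < c → Tendsto (fun r => c * r) (𝓝[>] 0) (𝓝[>] 0) := by
    intro c hc
    refine tendsto_nhdsWithin_iff.2 ⟨?_, ?_⟩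
    · exact tendsto_nhdsWithin_of_tendsto_nhds (Continuous.tendsto' (by fun_prop) _ _ (by simp))
    · filter_upwards [self_mem_nhdsWithin] with r hr using mul_pos hc hr
  constructor
  · refine EReal.le_of_forall_lt_iff_le.1 fun b hb => ?_
    obtain ⟨a, ha, hab⟩ := EReal.exists_between_coe_real hb
    have h1 := eventually_hitQuot_le hC hpos hret (EReal.coe_lt_coe_iff.1 hab)
    have h2 : ∀ᶠ r : ℝ in 𝓝[>] 0, hitQuot T x x (C * r) ≤ (b : EReal) := by
      filter_upwards [h1, eventually_lt_of_limsup_lt ha] with r h1 h2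
      exact h1 (EReal.coe_lt_coe_iff.1 h2)
    refine limsup_le_of_le (by isBoundedDefault) ?_
    filter_upwards [(hmul C⁻¹ (by positivity)).eventually h2] with r hr
    rwa [mul_inv_cancel_left₀ hC.ne'] at hr
  · refine EReal.le_of_forall_lt_iff_le.1 fun b hb => ?_
    obtain ⟨a, ha, hab⟩ := EReal.exists_between_coe_real hb
    have h1 := eventually_hitQuot_le hC hpos hret (EReal.coe_lt_coe_iff.1 hab)
    have h2 := (frequently_lt_of_liminf_lt (by isBoundedDefault) ha).and_eventually h1
    refine liminf_le_of_frequently_le' ((hmul C hC).frequently (h2.mono fun r hr => ?_))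
    exact hr.2 (EReal.coe_lt_coe_iff.1 hr.1)
end

section
/- Let (X,d) be a compact metric space, T : X → X a map, x₀ ∈ X, α > 1, and f : X∖{x₀} → [0,∞) a continuous function such that lim_{x→x₀} f(x)·d(x,x₀)^α = L for some L ∈ (0,∞). Let x ∈ X be a point such that T^i(x) ≠ x₀ for all i ≥ 0 and such that the hitting-time indicators satisfy 0 < R_(x,x₀) ≤ R̄(x,x₀) < ∞. Then the Birkhoff sums S_n(x) = Σ_{i=0}^{n} f(T^i(x)) satisfy α/R̄(x,x₀) ≤ limsup_{n→∞} log(S_n(x))/log(n) ≤ α/R_(x,x₀) + 1. -/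
open Filter MeasureTheory Metric Set

section HittingTime

variable {X : Type*} [MetricSpace X] {T : X → X} {x y : X}

lemma hitTime_le {r : ℝ} {k : ℕ} (hk : 0 < k) (h : T^[k] x ∈ ball y r) :
    hitTime T x y r ≤ k :=
  sInf_le ⟨k, rfl, hk, h⟩

lemma exists_eq_hitTime {r : ℝ} (h : hitTime T x y r ≠ ⊤) :
    ∃ k : ℕ, hitTime T x y r = k ∧ 0 < k ∧ T^[k] x ∈ ball y r := by
  have hne : {n : ℕ∞ | ∃ k : ℕ, n = k ∧ 0 < k ∧ T^[k] x ∈ ball y r}.Nonempty := by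
    by_contra hempty
    rw [not_nonempty_iff_eq_empty] at hempty
    exact h (by rw [hitTime, hempty, sInf_empty])
  exact csInf_mem hne

lemma tendsto_natCast_rpow_neg_inv {u : ℝ} (hu : 0 < u) :
    Tendsto (fun n : ℕ => (n : ℝ) ^ (-u⁻¹)) atTop (nhdsWithin 0 (Ioi 0)) := by
  refine tendsto_nhdsWithin_iff.2 ⟨?_, ?_⟩
  · exact (tendsto_rpow_neg_atTop (inv_pos.2 hu)).comp tendsto_natCast_atTop_atTop
  · filter_upwards [eventually_gt_atTop 0] with n hn
    exact Real.rpow_pos_of_pos (by exact_mod_cast hn) _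

/-- Above the upper indicator, the orbit up to time `n` enters the ball of radius `n ^ (-1/u)`. -/
lemma eventually_exists_mem_ball_of_Rbar_lt {u : ℝ} (hu : 0 < u) (h : Rbar T x y < u) :
    ∀ᶠ n : ℕ in atTop, ∃ k ≤ n, T^[k] x ∈ ball y ((n : ℝ) ^ (-u⁻¹)) := by
  filter_upwards [(tendsto_natCast_rpow_neg_inv hu).eventually (eventually_lt_of_limsup_lt h),
    eventually_gt_atTop 1] with n hn hn1
  have hn1' : (1 : ℝ) < n := by exact_mod_cast hn1
  have hlog : 0 < Real.log n := Real.log_pos hn1'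
  rw [hitQuot] at hn
  split_ifs at hn with htop
  · exact absurd hn not_top_lt
  obtain ⟨k, hk, hk0, hmem⟩ := exists_eq_hitTime htop
  refine ⟨k, ?_, hmem⟩
  rw [hk, EReal.coe_lt_coe_iff, Real.log_rpow (by linarith), neg_mul, neg_neg,
    div_lt_iff₀ (by positivity), ← mul_assoc, mul_inv_cancel₀ hu.ne', one_mul,
    ENat.toNat_natCast] at hn
  have := (Real.log_lt_log_iff (by exact_mod_cast hk0) (by linarith)).1 hn
  exact_mod_cast this.le

/-- Below the lower indicator, the orbit up to time `n` avoids the ball of radius `n ^ (-1/s)`. -/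
lemma eventually_forall_le_dist_of_lt_Rlow {s : ℝ} (hs : 0 < s) (h : (s : EReal) < Rlow T x y) :
    ∀ᶠ n : ℕ in atTop, ∀ k ≤ n, 0 < k → (n : ℝ) ^ (-s⁻¹) ≤ dist (T^[k] x) y := by
  filter_upwards [(tendsto_natCast_rpow_neg_inv hs).eventually (eventually_lt_of_lt_liminf h),
    eventually_gt_atTop 1] with n hn hn1 k hkn hk0
  have hn1' : (1 : ℝ) < n := by exact_mod_cast hn1
  have hlog : 0 < Real.log n := Real.log_pos hn1'
  by_contra! hlt
  have hle := hitTime_le hk0 (mem_ball.2 hlt)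
  have htop : hitTime T x y ((n : ℝ) ^ (-s⁻¹)) ≠ ⊤ := (hle.trans_lt (ENat.natCast_lt_top k)).ne
  obtain ⟨m, hm, hm0, -⟩ := exists_eq_hitTime htop
  rw [hitQuot, if_neg htop, hm, EReal.coe_lt_coe_iff, Real.log_rpow (by linarith), neg_mul,
    neg_neg, lt_div_iff₀ (by positivity), ← mul_assoc, mul_inv_cancel₀ hs.ne', one_mul,
    ENat.toNat_natCast] at hn
  have hnm := (Real.log_lt_log_iff (by linarith) (by exact_mod_cast hm0)).1 hn
  have hnm' : n < m := by exact_mod_cast hnm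
  have hmk : m ≤ k := by rw [hm] at hle; exact_mod_cast hle
  omega

end HittingTime

section GrowthRate

lemma limsup_log_const_div_log_add (c a : ℝ) :
    limsup (fun n : ℕ => ((Real.log c / Real.log n + a : ℝ) : EReal)) atTop = a := by
  refine Tendsto.limsup_eq ((continuous_coe_real_ereal.tendsto a).comp ?_)
  have h : Tendsto (fun n : ℕ => Real.log c / Real.log n) atTop (nhds 0) :=
    (Real.tendsto_log_atTop.comp tendsto_natCast_atTop_atTop).const_div_atTop _
  simpa using h.add_const a

lemma log_const_mul_rpow_div_log {c a : ℝ} (hc : 0 < c) {n : ℕ} (hn : 1 < n) :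
    Real.log (c * (n : ℝ) ^ a) / Real.log n = Real.log c / Real.log n + a := by
  have hn' : (1 : ℝ) < n := by exact_mod_cast hn
  have hlog : 0 < Real.log n := Real.log_pos hn'
  rw [Real.log_mul hc.ne' (Real.rpow_pos_of_pos (by linarith) _).ne',
    Real.log_rpow (by linarith), add_div, mul_div_cancel_right₀ _ hlog.ne']

lemma le_limsup_log_div_log {S : ℕ → ℝ} {c a : ℝ} (hc : 0 < c)
    (h : ∀ᶠ n : ℕ in atTop, c * (n : ℝ) ^ a ≤ S n) :
    (a : EReal) ≤ limsup (fun n : ℕ => ((Real.log (S n) / Real.log n : ℝ) : EReal)) atTop := by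
  rw [← limsup_log_const_div_log_add c a]
  refine limsup_le_limsup ?_
  filter_upwards [h, eventually_gt_atTop 1] with n hn hn1
  have hn1' : (1 : ℝ) < n := by exact_mod_cast hn1
  rw [EReal.coe_le_coe_iff, ← log_const_mul_rpow_div_log hc hn1]
  have := Real.log_pos hn1'
  gcongr

lemma limsup_log_div_log_le {S : ℕ → ℝ} {C a : ℝ} (hC : 1 ≤ C) (ha : 0 ≤ a)
    (h0 : ∀ n, 0 ≤ S n) (h : ∀ᶠ n : ℕ in atTop, S n ≤ C * (n : ℝ) ^ a) :
    limsup (fun n : ℕ => ((Real.log (S n) / Real.log n : ℝ) : EReal)) atTop ≤ (a : EReal) := by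
  rw [← limsup_log_const_div_log_add C a]
  refine limsup_le_limsup ?_
  filter_upwards [h, eventually_gt_atTop 1] with n hn hn1
  have hn1' : (1 : ℝ) < n := by exact_mod_cast hn1
  have hlog := Real.log_pos hn1'
  rw [EReal.coe_le_coe_iff, ← log_const_mul_rpow_div_log (by linarith) hn1]
  refine div_le_div_of_nonneg_right ?_ hlog.le
  rcases (h0 n).eq_or_lt with h0 | h0
  · rw [← h0, Real.log_zero]
    exact Real.log_nonneg (one_le_mul_of_one_le_of_one_le hC (Real.one_le_rpow hn1'.le ha))
  · exact Real.log_le_log h0 hn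

end GrowthRate

section Singularity

variable {X : Type*} [MetricSpace X] {x₀ : X} {f : X → ℝ} {α L : ℝ}

lemma exists_radius_bounds_of_tendsto (hL : 0 < L)
    (hlim : Tendsto (fun z => f z * dist z x₀ ^ α) (nhdsWithin x₀ {x₀}ᶜ) (nhds L)) :
    ∃ δ > 0, ∀ z ≠ x₀, dist z x₀ < δ →
      L / 2 * dist z x₀ ^ (-α) ≤ f z ∧ f z ≤ 2 * L * dist z x₀ ^ (-α) := by
  have h := hlim.eventually (Ioo_mem_nhds (show L / 2 < L by linarith) (show L < 2 * L by linarith))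
  rw [eventually_nhdsWithin_iff, Metric.eventually_nhds_iff] at h
  obtain ⟨δ, hδ, h⟩ := h
  refine ⟨δ, hδ, fun z hz hd => ?_⟩
  obtain ⟨h1, h2⟩ := h hd hz
  have hp : 0 < dist z x₀ ^ α := Real.rpow_pos_of_pos (dist_pos.2 hz) _
  rw [Real.rpow_neg dist_nonneg, ← div_eq_mul_inv, ← div_eq_mul_inv, div_le_iff₀ hp, le_div_iff₀ hp]
  exact ⟨h1.le, h2.le⟩

lemma exists_le_dist_rpow_add [CompactSpace X] (hfc : ContinuousOn f {x₀}ᶜ) (hL : 0 < L)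
    (hlim : Tendsto (fun z => f z * dist z x₀ ^ α) (nhdsWithin x₀ {x₀}ᶜ) (nhds L)) :
    ∃ M, 0 ≤ M ∧ ∀ z ≠ x₀, f z ≤ 2 * L * dist z x₀ ^ (-α) + M := by
  obtain ⟨δ, hδ, h⟩ := exists_radius_bounds_of_tendsto hL hlim
  have hK : IsCompact {z | δ ≤ dist z x₀} :=
    (isClosed_le continuous_const (continuous_id.dist continuous_const)).isCompact
  obtain ⟨M, hM⟩ := hK.exists_bound_of_continuousOn (hfc.mono fun z hz hz0 => by
    rw [mem_singleton_iff.1 hz0, mem_ofPred_eq, dist_self] at hz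
    linarith)
  refine ⟨|M|, abs_nonneg M, fun z hz => ?_⟩
  rcases lt_or_ge (dist z x₀) δ with hd | hd
  · linarith [(h z hz hd).2, abs_nonneg M]
  · have := (le_abs_self _).trans (hM z hd)
    have hp : 0 ≤ 2 * L * dist z x₀ ^ (-α) := by positivity
    linarith [le_abs_self M]

end Singularity

/-- growth rate of Birkhoff sums of a non-`L¹` observable with an
    asymptote of order `α` at `x₀`, in terms of the hitting-time indicators. -/
theorem birkhoff_growth_of_hitting {X : Type*} [MetricSpace X] [CompactSpace X]
    (T : X → X) (x₀ : X) (α : ℝ) (hα : 1 < α)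
    (f : X → ℝ) (hf0 : ∀ z, z ≠ x₀ → 0 ≤ f z) (hfc : ContinuousOn f {x₀}ᶜ)
    (L : ℝ) (hL : 0 < L)
    (hlim : Filter.Tendsto (fun z => f z * dist z x₀ ^ α) (nhdsWithin x₀ {x₀}ᶜ) (nhds L))
    (x : X) (horb : ∀ i : ℕ, T^[i] x ≠ x₀)
    (Rl Ru : ℝ) (hRl0 : 0 < Rl) (hRlu : Rl ≤ Ru)
    (hRl : Rlow T x x₀ = (Rl : EReal)) (hRu : Rbar T x x₀ = (Ru : EReal)) :
    ((α / Ru : ℝ) : EReal) ≤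
        Filter.limsup (fun n : ℕ =>
          ((Real.log (∑ i ∈ Finset.range (n + 1), f (T^[i] x)) / Real.log (n : ℝ) : ℝ) : EReal))
          Filter.atTop ∧
      Filter.limsup (fun n : ℕ =>
          ((Real.log (∑ i ∈ Finset.range (n + 1), f (T^[i] x)) / Real.log (n : ℝ) : ℝ) : EReal))
          Filter.atTop ≤ ((α / Rl + 1 : ℝ) : EReal) := by
  have hRu0 : 0 < Ru := hRl0.trans_le hRlu
  have hα0 : 0 < α := by linarith
  have hf0' : ∀ i, 0 ≤ f (T^[i] x) := fun i => hf0 _ (horb i)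
  constructor
  · have hu : ∀ u, Ru < u → ((α / u : ℝ) : EReal) ≤ limsup (fun n : ℕ =>
        ((Real.log (∑ i ∈ Finset.range (n + 1), f (T^[i] x)) / Real.log (n : ℝ) : ℝ) : EReal))
          atTop := by
      intro u hu
      have hu0 : 0 < u := hRu0.trans hu
      obtain ⟨δ, hδ, hf⟩ := exists_radius_bounds_of_tendsto hL hlim
      refine le_limsup_log_div_log (half_pos hL) ?_
      filter_upwards [eventually_exists_mem_ball_of_Rbar_lt hu0
          (hRu.trans_lt (EReal.coe_lt_coe_iff.2 hu)),
        ((tendsto_natCast_rpow_neg_inv hu0).mono_right nhdsWithin_le_nhds).eventually_lt_const hδ]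
        with n ⟨k, hkn, hk⟩ hnδ
      rw [mem_ball] at hk
      calc L / 2 * (n : ℝ) ^ (α / u) = L / 2 * ((n : ℝ) ^ (-u⁻¹)) ^ (-α) := by
            rw [← Real.rpow_mul n.cast_nonneg]
            congr 2
            ring
        _ ≤ L / 2 * dist (T^[k] x) x₀ ^ (-α) := by
            gcongr L / 2 * ?_
            exact Real.rpow_le_rpow_of_nonpos (dist_pos.2 (horb k)) hk.le (by linarith)
        _ ≤ f (T^[k] x) := (hf _ (horb k) (hk.trans hnδ)).1
        _ ≤ ∑ i ∈ Finset.range (n + 1), f (T^[i] x) :=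
            Finset.single_le_sum (f := fun i => f (T^[i] x)) (fun i _ => hf0' i)
              (Finset.mem_range.2 (Nat.lt_succ_of_le hkn))
    have ht : Tendsto (fun u : ℝ => ((α / u : ℝ) : EReal)) (nhdsWithin Ru (Ioi Ru))
        (nhds ((α / Ru : ℝ) : EReal)) :=
      (continuous_coe_real_ereal.tendsto _).comp
        ((tendsto_const_nhds.div tendsto_id hRu0.ne').mono_left nhdsWithin_le_nhds)
    exact le_of_tendsto ht (eventually_nhdsWithin_of_forall hu)
  · have hs : ∀ s ∈ Ioo 0 Rl, limsup (fun n : ℕ =>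
        ((Real.log (∑ i ∈ Finset.range (n + 1), f (T^[i] x)) / Real.log (n : ℝ) : ℝ) : EReal))
          atTop ≤ ((α / s + 1 : ℝ) : EReal) := by
      rintro s ⟨hs0, hs⟩
      obtain ⟨M, hM0, hf⟩ := exists_le_dist_rpow_add hfc hL hlim
      have hfx := hf0' 0
      refine limsup_log_div_log_le (C := 1 + f (T^[0] x) + (2 * L + M)) (by linarith)
        (by positivity) (fun n => Finset.sum_nonneg fun i _ => hf0' i) ?_
      filter_upwards [eventually_forall_le_dist_of_lt_Rlow hs0
          ((EReal.coe_lt_coe_iff.2 hs).trans_eq hRl.symm), eventually_gt_atTop 0] with n hn hn0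
      have hn1 : (1 : ℝ) ≤ n := by exact_mod_cast hn0
      have hn0' : (0 : ℝ) < n := by linarith
      have hp : (1 : ℝ) ≤ (n : ℝ) ^ (α / s) := Real.one_le_rpow hn1 (by positivity)
      have hterm : ∀ i ∈ Finset.range n, f (T^[i + 1] x) ≤ (2 * L + M) * (n : ℝ) ^ (α / s) := by
        intro i hi
        have hd := hn (i + 1) (Finset.mem_range.1 hi) i.succ_pos
        have hpow : dist (T^[i + 1] x) x₀ ^ (-α) ≤ (n : ℝ) ^ (α / s) := by
          calc dist (T^[i + 1] x) x₀ ^ (-α) ≤ ((n : ℝ) ^ (-s⁻¹)) ^ (-α) :=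
                Real.rpow_le_rpow_of_nonpos (Real.rpow_pos_of_pos hn0' _) hd (by linarith)
            _ = (n : ℝ) ^ (α / s) := by
                rw [← Real.rpow_mul n.cast_nonneg]
                congr 1
                ring
        calc f (T^[i + 1] x) ≤ 2 * L * dist (T^[i + 1] x) x₀ ^ (-α) + M := hf _ (horb _)
          _ ≤ 2 * L * (n : ℝ) ^ (α / s) + M * (n : ℝ) ^ (α / s) := by
              gcongr
              exact le_mul_of_one_le_right hM0 hp
          _ = (2 * L + M) * (n : ℝ) ^ (α / s) := by ring
      have hsum := Finset.sum_le_card_nsmul _ _ _ hterm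
      rw [Finset.card_range, nsmul_eq_mul] at hsum
      rw [Finset.sum_range_succ', Real.rpow_add hn0', Real.rpow_one]
      have hq : 1 ≤ (n : ℝ) ^ (α / s) * n := one_le_mul_of_one_le_of_one_le hp hn1
      nlinarith [mul_le_mul_of_nonneg_left hq hfx]
    have ht : Tendsto (fun s : ℝ => ((α / s + 1 : ℝ) : EReal)) (nhdsWithin Rl (Iio Rl))
        (nhds ((α / Rl + 1 : ℝ) : EReal)) :=
      (continuous_coe_real_ereal.tendsto _).comp
        (((tendsto_const_nhds.div tendsto_id hRl0.ne').add_const 1).mono_left nhdsWithin_le_nhds)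
    refine ge_of_tendsto ht ?_
    filter_upwards [Ioo_mem_nhdsLT hRl0] with s hs' using hs s hs'
end
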